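/- Let 0<q<1 and let α,β be real with α,β>−1. For every integer n≥2 and every x∈ℂ: P_n^{(α,β)}(x|q) = [q^{−n/2}(1−q^{α+β+n+1})(1−q^{α+β+n+2})/((1+q^{(α+β+1)/2})(1+q^{(α+β+2)/2})(1−q^{n+(α+β+1)/2})(1−q^{n+(α+β+2)/2}))]·P_n^{(α+1,β+1)}(x|q) + [q^{(α+β+2−n)/2}(1−q^{α+β+n+1})(1+q^{n+(α+β+1)/2})(1−q^{(α−β)/2})/((1+q^{(α+β+1)/2})(1+q^{(α+β+2)/2})(1−q^{n+(α+β)/2})(1−q^{n+(α+β+2)/2}))]·P_{n−1}^{(α+1,β+1)}(x|q) − [q^{(3α+β+4−n)/2}(1−q^{α+n})(1−q^{β+n})/((1+q^{(α+β+1)/2})(1+q^{(α+β+2)/2})(1−q^{n+(α+β)/2})(1−q^{n+(α+β+1)/2}))]·P_{n−2}^{(α+1,β+1)}(x|q). -/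

import Mathlib

open Finset Filter

/-- `rpw q t` is the complex number `q^t` (real power, `q > 0`). -/
noncomputable def rpw (q t : ℝ) : ℂ := ((q ^ t : ℝ) : ℂ)

/-- Finite q-shifted factorial `(a; qq)_n`. -/
noncomputable def qPoch (a qq : ℂ) (n : ℕ) : ℂ := ∏ j ∈ Finset.range n, (1 - a * qq ^ j)

/-- Continuous q-Jacobi polynomial `P_n^{(α,β)}(x|q)` (Askey–Wilson normalization). -/
noncomputable def Paw (q α β : ℝ) (n : ℕ) (x : ℂ) : ℂ :=
  (qPoch (rpw q (α + 1)) (q : ℂ) n / qPoch (q : ℂ) (q : ℂ) n) *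
  ∑ k ∈ Finset.range (n + 1),
    (qPoch (rpw q (-(n : ℝ))) (q : ℂ) k * qPoch (rpw q ((n : ℝ) + α + β + 1)) (q : ℂ) k /
      (qPoch (q : ℂ) (q : ℂ) k * qPoch (rpw q (α + 1)) (q : ℂ) k *
       qPoch (-(rpw q ((α + β + 1)/2))) (q : ℂ) k *
       qPoch (-(rpw q ((α + β + 2)/2))) (q : ℂ) k)) *
    (q : ℂ) ^ k *
    ∏ j ∈ Finset.range k,
      (1 - 2 * x * rpw q ((2*α + 1)/4 + (j : ℝ)) + rpw q ((2*α + 1)/2 + 2 * (j : ℝ)))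


/-- Coefficient of degree `n + 2` in the Askey-Wilson recurrence at degree `n + 1`; `P = q ^ n`. -/
noncomputable def awUp (q a b c d P : ℂ) : ℂ :=
  (1 - a * b * (P * q)) * (1 - a * c * (P * q)) * (1 - a * d * (P * q)) *
    (1 - a * b * c * d * P) /
    (a * (1 - a * b * c * d * P ^ 2 * q) * (1 - a * b * c * d * P ^ 2 * q ^ 2))

/-- Coefficient of degree `n` in the Askey-Wilson recurrence at degree `n + 1`; `P = q ^ n`. -/
noncomputable def awDown (q a b c d P : ℂ) : ℂ :=
  a * (1 - P * q) * (1 - b * c * P) * (1 - b * d * P) * (1 - c * d * P) /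
    ((1 - a * b * c * d * P ^ 2) * (1 - a * b * c * d * P ^ 2 * q))

lemma awUp_mul_sub (q a b c d P K : ℂ) (hq : q ≠ 0) (ha : a ≠ 0) (hP : P ≠ 0)
    (hD : 1 - a * b * c * d * P ≠ 0) (hD1 : 1 - a * b * c * d * P ^ 2 * q ≠ 0)
    (hD2 : 1 - a * b * c * d * P ^ 2 * q ^ 2 ≠ 0) :
    awUp q a b c d P *
      ((1 - 1 / (P * q * q)) * (1 - a * b * c * d * P * K) * (1 - a * b * c * d * P * q * K) /
          (1 - a * b * c * d * P) - (1 - K / (P * q)) * (1 - a * b * c * d * P * K)) =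
      - ((1 - a * b * (P * q)) * (1 - a * c * (P * q)) * (1 - a * d * (P * q)) *
        (1 - a * b * c * d * P * K) * (1 - K * q) /
        (a * P * q ^ 2 * (1 - a * b * c * d * P ^ 2 * q))) := by
  unfold awUp
  generalize h : 1 - a * b * c * d * P = E at *
  generalize h1 : 1 - a * b * c * d * P ^ 2 * q = E1 at *
  generalize h2 : 1 - a * b * c * d * P ^ 2 * q ^ 2 = E2 at *
  field_simp
  subst h h1 h2
  ring

lemma awDown_mul_sub (q a b c d P K : ℂ) (hq : q ≠ 0) (hP : P ≠ 0) (hPq : 1 - P * q ≠ 0)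
    (hD0 : 1 - a * b * c * d * P ^ 2 ≠ 0) (hD1 : 1 - a * b * c * d * P ^ 2 * q ≠ 0) :
    awDown q a b c d P *
      ((1 - K / (P * q)) * (1 - K * q / (P * q)) * (1 - a * b * c * d / q * P) /
          (1 - 1 / (P * q)) - (1 - K / (P * q)) * (1 - a * b * c * d * P * K)) =
      - (a * (1 - b * c * P) * (1 - b * d * P) * (1 - c * d * P) * (P * q - K) * (1 - K * q) /
        (P * q * (1 - a * b * c * d * P ^ 2 * q))) := by
  unfold awDown
  have : 1 - 1 / (P * q) = -(1 - P * q) / (P * q) := by field_simp; ring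
  rw [this]
  generalize h : 1 - P * q = E at *
  generalize h1 : 1 - a * b * c * d * P ^ 2 = E1 at *
  generalize h2 : 1 - a * b * c * d * P ^ 2 * q = E2 at *
  field_simp
  subst h h1 h2
  ring

/-- The coefficient relation behind the three-term recurrence, with `P = q ^ n` and `K = q ^ k`. -/
lemma aw_recurrence_algebra (q a b c d P K : ℂ) (hq : q ≠ 0) (ha : a ≠ 0) (hP : P ≠ 0)
    (hK : K ≠ 0) (hPq : 1 - P * q ≠ 0) (hD : 1 - a * b * c * d * P ≠ 0)
    (hD0 : 1 - a * b * c * d * P ^ 2 ≠ 0) (hD1 : 1 - a * b * c * d * P ^ 2 * q ≠ 0)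
    (hD2 : 1 - a * b * c * d * P ^ 2 * q ^ 2 ≠ 0) :
    (1 - K / (P * q)) * (1 - a * b * c * d * P * K) *
        (1 / (a * (K * q)) + a * (K * q) - a - 1 / a) -
      (1 - q * K) * (1 - a * b * K) * (1 - a * c * K) * (1 - a * d * K) / (a * K * q) =
    awUp q a b c d P *
      ((1 - 1 / (P * q * q)) * (1 - a * b * c * d * P * K) * (1 - a * b * c * d * P * q * K) /
          (1 - a * b * c * d * P) - (1 - K / (P * q)) * (1 - a * b * c * d * P * K)) +
    awDown q a b c d P *
      ((1 - K / (P * q)) * (1 - K * q / (P * q)) * (1 - a * b * c * d / q * P) /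
          (1 - 1 / (P * q)) - (1 - K / (P * q)) * (1 - a * b * c * d * P * K)) := by
  rw [awUp_mul_sub q a b c d P K hq ha hP hD hD1 hD2,
    awDown_mul_sub q a b c d P K hq hP hPq hD0 hD1]
  generalize h1 : 1 - a * b * c * d * P ^ 2 * q = E1 at *
  field_simp
  subst h1
  ring

lemma aw_symm_algebra (q a b c d P : ℂ) (ha : a ≠ 0) (hb : b ≠ 0)
    (hD0 : 1 - a * b * c * d * P ^ 2 ≠ 0) (hD1 : 1 - a * b * c * d * P ^ 2 * q ≠ 0)
    (hD2 : 1 - a * b * c * d * P ^ 2 * q ^ 2 ≠ 0) :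
    a + 1 / a - awUp q a b c d P - awDown q a b c d P =
    b + 1 / b - awUp q b a c d P - awDown q b a c d P := by
  unfold awUp awDown
  rw [mul_comm b a]
  generalize h0 : 1 - a * b * c * d * P ^ 2 = E0 at *
  generalize h1 : 1 - a * b * c * d * P ^ 2 * q = E1 at *
  generalize h2 : 1 - a * b * c * d * P ^ 2 * q ^ 2 = E2 at *
  field_simp
  subst h0 h1 h2
  ring

lemma qPoch_succ (a q : ℂ) (n : ℕ) : qPoch a q (n + 1) = qPoch a q n * (1 - a * q ^ n) :=
  Finset.prod_range_succ _ _

lemma qPoch_succ_left (a q : ℂ) (n : ℕ) :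
    qPoch a q (n + 1) = (1 - a) * qPoch (a * q) q n := by
  unfold qPoch
  rw [Finset.prod_range_succ', mul_comm]
  simp [pow_succ', mul_assoc]

lemma qPoch_mul_left (a q : ℂ) (n : ℕ) :
    (1 - a) * qPoch (a * q) q n = qPoch a q n * (1 - a * q ^ n) := by
  rw [← qPoch_succ_left, qPoch_succ]

lemma qPoch_ne_zero {a q : ℂ} (h : ∀ k : ℕ, 1 - a * q ^ k ≠ 0) (n : ℕ) : qPoch a q n ≠ 0 :=
  Finset.prod_ne_zero_iff.2 fun k _ => h k

/-- The Askey-Wilson basis polynomial `(a e^{iθ}, a e^{-iθ}; q)_k` at `x = cos θ`. -/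
noncomputable def awBasis (q a x : ℂ) (k : ℕ) : ℂ :=
  ∏ j ∈ Finset.range k, (1 - 2 * x * (a * q ^ j) + (a * q ^ j) ^ 2)

/-- Coefficients of the `₄φ₃` series of the Askey-Wilson polynomial in `awBasis q a x`. -/
noncomputable def awCoeff (q a b c d : ℂ) (n k : ℕ) : ℂ :=
  qPoch ((q ^ n)⁻¹) q k * qPoch (a * b * c * d / q * q ^ n) q k /
    (qPoch q q k * qPoch (a * b) q k * qPoch (a * c) q k * qPoch (a * d) q k) * q ^ k

/-- The `₄φ₃` series of the Askey-Wilson polynomial of degree `n`. -/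
noncomputable def awSeries (q a b c d : ℂ) (n : ℕ) (x : ℂ) : ℂ :=
  ∑ k ∈ Finset.range (n + 1), awCoeff q a b c d n k * awBasis q a x k

/-- Non-degeneracy of Askey-Wilson parameters, for both `a` and `b` as distinguished parameter. -/
structure AWRegular (q a b c d : ℂ) : Prop where
  q_ne : q ≠ 0
  a_ne : a ≠ 0
  b_ne : b ≠ 0
  qq : ∀ k : ℕ, 1 - q * q ^ k ≠ 0
  ab : ∀ k : ℕ, 1 - a * b * q ^ k ≠ 0
  ac : ∀ k : ℕ, 1 - a * c * q ^ k ≠ 0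
  ad : ∀ k : ℕ, 1 - a * d * q ^ k ≠ 0
  bc : ∀ k : ℕ, 1 - b * c * q ^ k ≠ 0
  bd : ∀ k : ℕ, 1 - b * d * q ^ k ≠ 0
  abcd : ∀ k : ℕ, 1 - a * b * c * d * q ^ k ≠ 0

lemma AWRegular.swap {q a b c d : ℂ} (h : AWRegular q a b c d) : AWRegular q b a c d where
  q_ne := h.q_ne
  a_ne := h.b_ne
  b_ne := h.a_ne
  qq := h.qq
  ab := by simpa only [mul_comm b a] using h.ab
  ac := h.bc
  ad := h.bd
  bc := h.ac
  bd := h.ad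
  abcd := by simpa only [mul_comm b a] using h.abcd

lemma awCoeff_eq_zero {q : ℂ} (hq : q ≠ 0) (a b c d : ℂ) {n k : ℕ} (h : n < k) :
    awCoeff q a b c d n k = 0 := by
  have : qPoch ((q ^ n)⁻¹) q k = 0 :=
    Finset.prod_eq_zero (Finset.mem_range.2 h) (by rw [inv_mul_cancel₀ (pow_ne_zero n hq), sub_self])
  simp [awCoeff, this]

lemma awCoeff_zero_right (q a b c d : ℂ) (n : ℕ) : awCoeff q a b c d n 0 = 1 := by
  simp [awCoeff, qPoch]

lemma awSeries_eq_sum {q : ℂ} (hq : q ≠ 0) (a b c d x : ℂ) {n N : ℕ} (h : n < N) :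
    awSeries q a b c d n x =
      ∑ k ∈ Finset.range N, awCoeff q a b c d n k * awBasis q a x k := by
  refine Finset.sum_subset (Finset.range_subset_range.2 h) fun k _ hk => ?_
  rw [awCoeff_eq_zero hq a b c d (by simpa [Nat.lt_succ_iff] using hk), zero_mul]

lemma awBasis_succ (q a x : ℂ) (k : ℕ) :
    awBasis q a x (k + 1) = awBasis q a x k * (1 - 2 * x * (a * q ^ k) + (a * q ^ k) ^ 2) :=
  Finset.prod_range_succ _ _

/-- The factor produced by the denominators when `k` increases by one. -/
noncomputable def awRatio (q a b c d K : ℂ) : ℂ :=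
  q / ((1 - q * K) * (1 - a * b * K) * (1 - a * c * K) * (1 - a * d * K))

lemma awCoeff_succ_right (q a b c d : ℂ) (n k : ℕ) :
    awCoeff q a b c d n (k + 1) =
      qPoch ((q ^ n)⁻¹) q (k + 1) * qPoch (a * b * c * d / q * q ^ n) q (k + 1) *
      (q ^ k / (qPoch q q k * qPoch (a * b) q k * qPoch (a * c) q k * qPoch (a * d) q k)) *
      awRatio q a b c d (q ^ k) := by
  unfold awCoeff awRatio
  rw [qPoch_succ q, qPoch_succ (a * b), qPoch_succ (a * c), qPoch_succ (a * d), pow_succ]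
  simp only [div_eq_mul_inv, mul_inv]
  ring

lemma awCoeff_succ_same {q a b c d : ℂ} (hq : q ≠ 0) (n k : ℕ) :
    awCoeff q a b c d (n + 1) (k + 1) =
      awCoeff q a b c d (n + 1) k * awRatio q a b c d (q ^ k) *
      ((1 - q ^ k / (q ^ n * q)) * (1 - a * b * c * d * q ^ n * q ^ k)) := by
  rw [awCoeff_succ_right, qPoch_succ, qPoch_succ]
  have : a * b * c * d / q * q ^ (n + 1) = a * b * c * d * q ^ n := by
    field_simp
    ring
  simp only [awCoeff, this]
  rw [pow_succ q n]
  ring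

lemma awCoeff_succ_up {q a b c d : ℂ} (h : AWRegular q a b c d) (n k : ℕ) :
    awCoeff q a b c d (n + 2) (k + 1) =
      awCoeff q a b c d (n + 1) k * awRatio q a b c d (q ^ k) *
      ((1 - 1 / (q ^ n * q * q)) * (1 - a * b * c * d * q ^ n * q ^ k) *
        (1 - a * b * c * d * q ^ n * q * q ^ k) / (1 - a * b * c * d * q ^ n)) := by
  have hq := h.q_ne
  have hD := h.abcd n
  have e1 : a * b * c * d / q * q ^ (n + 1) = a * b * c * d * q ^ n := by
    field_simp
    ring
  have e2 : a * b * c * d / q * q ^ (n + 2) = a * b * c * d * q ^ n * q := by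
    field_simp
    ring
  have e3 : (q ^ (n + 2))⁻¹ * q = (q ^ (n + 1))⁻¹ := by
    rw [pow_succ q (n + 1)]
    field_simp
  have e4 := qPoch_mul_left (a * b * c * d * q ^ n) q (k + 1)
  rw [awCoeff_succ_right, qPoch_succ_left, e2, e3]
  rw [show qPoch (a * b * c * d * q ^ n * q) q (k + 1) =
    qPoch (a * b * c * d * q ^ n) q (k + 1) * (1 - a * b * c * d * q ^ n * q ^ (k + 1)) /
      (1 - a * b * c * d * q ^ n) from by rw [← e4]; field_simp]
  rw [qPoch_succ (a * b * c * d * q ^ n)]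
  simp only [awCoeff, e1]
  rw [show q ^ (n + 2) = q ^ n * q * q by ring, one_div, pow_succ q k]
  ring

lemma awCoeff_succ_down {q a b c d : ℂ} (h : AWRegular q a b c d) (n k : ℕ) :
    awCoeff q a b c d n (k + 1) =
      awCoeff q a b c d (n + 1) k * awRatio q a b c d (q ^ k) *
      ((1 - q ^ k / (q ^ n * q)) * (1 - q ^ k * q / (q ^ n * q)) *
        (1 - a * b * c * d / q * q ^ n) / (1 - 1 / (q ^ n * q))) := by
  have hq := h.q_ne
  have e1 : a * b * c * d / q * q ^ (n + 1) = a * b * c * d / q * q ^ n * q := by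
    ring
  have e3 : (q ^ (n + 1))⁻¹ * q = (q ^ n)⁻¹ := by
    rw [pow_succ q n]
    field_simp
  have e4 := qPoch_mul_left ((q ^ (n + 1))⁻¹) q (k + 1)
  have hn : 1 - (q ^ (n + 1))⁻¹ ≠ 0 := by
    intro h0
    apply h.qq n
    rw [← pow_succ', sub_eq_zero]
    exact (inv_eq_one.1 (sub_eq_zero.1 h0).symm).symm
  rw [e3] at e4
  rw [awCoeff_succ_right, qPoch_succ_left (a * b * c * d / q * q ^ n)]
  rw [show qPoch ((q ^ n)⁻¹) q (k + 1) =
    qPoch ((q ^ (n + 1))⁻¹) q (k + 1) * (1 - (q ^ (n + 1))⁻¹ * q ^ (k + 1)) /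
      (1 - (q ^ (n + 1))⁻¹) from (eq_div_iff hn).2 (by rw [← e4, mul_comm])]
  rw [qPoch_succ ((q ^ (n + 1))⁻¹)]
  simp only [awCoeff, e1]
  rw [show q ^ (n + 1) = q ^ n * q by ring, one_div, pow_succ q k]
  ring

lemma awCoeff_recurrence {q a b c d : ℂ} (h : AWRegular q a b c d) (n k : ℕ) :
    awCoeff q a b c d (n + 1) (k + 1) *
        (1 / (a * (q ^ k * q)) + a * (q ^ k * q) - a - 1 / a) -
      awCoeff q a b c d (n + 1) k / (a * q ^ k) =
    awUp q a b c d (q ^ n) *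
        (awCoeff q a b c d (n + 2) (k + 1) - awCoeff q a b c d (n + 1) (k + 1)) +
      awDown q a b c d (q ^ n) *
        (awCoeff q a b c d n (k + 1) - awCoeff q a b c d (n + 1) (k + 1)) := by
  have hq := h.q_ne
  have hab := h.ab k
  have hac := h.ac k
  have had := h.ad k
  have hqq := h.qq k
  have ha := h.a_ne
  have hK : q ^ k ≠ 0 := pow_ne_zero k hq
  have hr : (1 - q * q ^ k) * (1 - a * b * q ^ k) * (1 - a * c * q ^ k) * (1 - a * d * q ^ k) /
      (a * q ^ k * q) * awRatio q a b c d (q ^ k) = 1 / (a * q ^ k) := by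
    unfold awRatio
    generalize 1 - q * q ^ k = E at *
    generalize 1 - a * b * q ^ k = E1 at *
    generalize 1 - a * c * q ^ k = E2 at *
    generalize 1 - a * d * q ^ k = E3 at *
    field_simp
  have key := aw_recurrence_algebra q a b c d (q ^ n) (q ^ k) hq ha (pow_ne_zero n hq)
    hK (by simpa only [mul_comm q] using h.qq n) (h.abcd n)
    (by have := h.abcd (2 * n); rwa [pow_mul'] at this)
    (by have := h.abcd (2 * n + 1); rwa [pow_succ, pow_mul', ← mul_assoc] at this)
    (by have := h.abcd (2 * n + 2); rwa [pow_add, pow_mul', ← mul_assoc] at this)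
  rw [awCoeff_succ_up h n k, awCoeff_succ_down h n k, awCoeff_succ_same hq n k]
  linear_combination (awCoeff q a b c d (n + 1) k * awRatio q a b c d (q ^ k)) * key +
    awCoeff q a b c d (n + 1) k * hr

/-- The three-term recurrence of the Askey-Wilson polynomials. -/
lemma awSeries_recurrence {q a b c d : ℂ} (h : AWRegular q a b c d) (n : ℕ) (x : ℂ) :
    awUp q a b c d (q ^ n) * awSeries q a b c d (n + 2) x =
      (2 * x - (a + 1 / a - awUp q a b c d (q ^ n) - awDown q a b c d (q ^ n))) *
        awSeries q a b c d (n + 1) x -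
      awDown q a b c d (q ^ n) * awSeries q a b c d n x := by
  have hq := h.q_ne
  have ha := h.a_ne
  rw [awSeries_eq_sum hq a b c d x (show n + 2 < n + 3 by lia),
    awSeries_eq_sum hq a b c d x (show n + 1 < n + 3 by lia),
    awSeries_eq_sum hq a b c d x (show n < n + 3 by lia)]
  have hmul (k : ℕ) : (2 * x - (a + 1 / a)) * awBasis q a x k =
      (1 / (a * q ^ k) + a * q ^ k - a - 1 / a) * awBasis q a x k -
        awBasis q a x (k + 1) / (a * q ^ k) := by
    rw [awBasis_succ]
    have := pow_ne_zero k hq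
    field_simp
    ring
  have hx : ∑ k ∈ Finset.range (n + 3),
        (2 * x - (a + 1 / a)) * (awCoeff q a b c d (n + 1) k * awBasis q a x k) =
      ∑ k ∈ Finset.range (n + 3),
        (awUp q a b c d (q ^ n) * (awCoeff q a b c d (n + 2) k - awCoeff q a b c d (n + 1) k) +
          awDown q a b c d (q ^ n) * (awCoeff q a b c d n k - awCoeff q a b c d (n + 1) k)) *
        awBasis q a x k := by
    have e (k : ℕ) : (2 * x - (a + 1 / a)) * (awCoeff q a b c d (n + 1) k * awBasis q a x k) =
        awCoeff q a b c d (n + 1) k * (1 / (a * q ^ k) + a * q ^ k - a - 1 / a) * awBasis q a x k -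
        awCoeff q a b c d (n + 1) k / (a * q ^ k) * awBasis q a x (k + 1) := by
      linear_combination awCoeff q a b c d (n + 1) k * hmul k
    simp_rw [e]
    rw [Finset.sum_sub_distrib, Finset.sum_range_succ',
      Finset.sum_range_succ (fun k => awCoeff q a b c d (n + 1) k / (a * q ^ k) * _),
      Finset.sum_range_succ' _ (n + 2), awCoeff_eq_zero hq a b c d (show n + 1 < n + 2 by lia)]
    simp only [awCoeff_zero_right]
    have e' (k : ℕ) := congrArg (· * awBasis q a x (k + 1)) (awCoeff_recurrence h n k)
    simp_rw [← e', sub_mul, Finset.sum_sub_distrib, pow_succ]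
    simp
  simp only [Finset.mul_sum] at hx ⊢
  have hx' := sub_eq_zero.2 hx
  rw [← Finset.sum_sub_distrib] at hx' ⊢
  rw [← sub_eq_zero, ← Finset.sum_sub_distrib, ← neg_eq_zero, ← Finset.sum_neg_distrib, ← hx']
  refine Finset.sum_congr rfl fun k _ => ?_
  ring

/-- Ratio of the `₄φ₃` series with distinguished parameters `a` and `b`. -/
noncomputable def awSwap (q a b c d : ℂ) (n : ℕ) : ℂ :=
  qPoch (b * c) q n * qPoch (b * d) q n / (qPoch (a * c) q n * qPoch (a * d) q n) * (a / b) ^ n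

lemma awSwap_succ (q a b c d : ℂ) (n : ℕ) :
    awSwap q a b c d (n + 1) = awSwap q a b c d n *
      ((1 - b * c * q ^ n) * (1 - b * d * q ^ n) /
        ((1 - a * c * q ^ n) * (1 - a * d * q ^ n)) * (a / b)) := by
  simp only [awSwap, qPoch_succ, pow_succ, div_eq_mul_inv, mul_inv]
  ring

lemma awUp_mul_awSwap {q a b c d : ℂ} (h : AWRegular q a b c d) (n : ℕ) :
    awUp q a b c d (q ^ n) * awSwap q a b c d (n + 2) =
      awUp q b a c d (q ^ n) * awSwap q a b c d (n + 1) := by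
  have ha := h.a_ne
  have hb := h.b_ne
  have hac := h.ac (n + 1)
  have had := h.ad (n + 1)
  rw [awSwap_succ q a b c d (n + 1)]
  unfold awUp
  rw [mul_comm b a]
  rw [← pow_succ q n]
  generalize q ^ (n + 1) = Q at *
  generalize 1 - a * c * Q = E3 at *
  generalize 1 - a * d * Q = E4 at *
  generalize 1 - a * b * c * d * (q ^ n) ^ 2 * q = E1 at *
  generalize 1 - a * b * c * d * (q ^ n) ^ 2 * q ^ 2 = E2 at *
  field_simp

lemma awDown_mul_awSwap {q a b c d : ℂ} (h : AWRegular q a b c d) (n : ℕ) :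
    awDown q a b c d (q ^ n) * awSwap q a b c d n =
      awDown q b a c d (q ^ n) * awSwap q a b c d (n + 1) := by
  have ha := h.a_ne
  have hb := h.b_ne
  have hac := h.ac n
  have had := h.ad n
  rw [awSwap_succ q a b c d n]
  unfold awDown
  rw [mul_comm b a]
  generalize q ^ n = Q at *
  generalize 1 - a * c * Q = E3 at *
  generalize 1 - a * d * Q = E4 at *
  generalize 1 - a * b * c * d * Q ^ 2 * q = E1 at *
  generalize 1 - a * b * c * d * Q ^ 2 = E2 at *
  field_simp

lemma awUp_ne_zero {q a b c d : ℂ} (h : AWRegular q a b c d) (n : ℕ) :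
    awUp q a b c d (q ^ n) ≠ 0 := by
  have e1 := h.ab (n + 1)
  have e2 := h.ac (n + 1)
  have e3 := h.ad (n + 1)
  have e4 := h.abcd (2 * n + 1)
  have e5 := h.abcd (2 * n + 2)
  rw [pow_succ, pow_mul', ← mul_assoc] at e4
  rw [pow_add, pow_mul', ← mul_assoc] at e5
  unfold awUp
  rw [← pow_succ q n]
  exact div_ne_zero (mul_ne_zero (mul_ne_zero (mul_ne_zero e1 e2) e3) (h.abcd n))
    (mul_ne_zero (mul_ne_zero h.a_ne e4) e5)

lemma awSeries_zero (q a b c d x : ℂ) : awSeries q a b c d 0 x = 1 := by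
  simp [awSeries, awCoeff, awBasis, qPoch]

lemma awSeries_one {q a b c d : ℂ} (h : AWRegular q a b c d) (x : ℂ) :
    awSeries q a b c d 1 x = 1 - (1 - a * b * c * d) * (1 - 2 * x * a + a ^ 2) /
      ((1 - a * b) * (1 - a * c) * (1 - a * d)) := by
  have hq := h.q_ne
  have h1 := h.qq 0
  have h2 : 1 - q⁻¹ = - (1 - q) / q := by
    field_simp
    ring
  simp only [pow_zero, mul_one] at h1
  simp only [awSeries, awCoeff, awBasis, qPoch, Finset.sum_range_succ, Finset.prod_range_succ,
    Finset.sum_range_zero, Finset.prod_range_zero, pow_zero, pow_one, mul_one, one_mul, zero_add,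
    div_one, h2, div_mul_cancel₀ _ hq]
  simp only [div_eq_mul_inv, mul_inv]
  field_simp
  ring

/-- Symmetry of the Askey-Wilson polynomials in `a` and `b`. -/
theorem awSeries_swap {q a b c d : ℂ} (h : AWRegular q a b c d) (n : ℕ) (x : ℂ) :
    awSeries q a b c d n x = awSwap q a b c d n * awSeries q b a c d n x := by
  induction n using Nat.twoStepInduction with
  | zero => simp [awSeries_zero, awSwap, qPoch]
  | one =>
    have ha := h.a_ne
    have hb := h.b_ne
    have h1 := h.ab 0
    have h2 := h.ac 0
    have h3 := h.ad 0
    have h4 := h.bc 0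
    have h5 := h.bd 0
    simp only [pow_zero, mul_one] at h1 h2 h3 h4 h5
    rw [awSeries_one h, awSeries_one h.swap]
    simp only [awSwap, qPoch, Finset.prod_range_one, pow_zero, mul_one, pow_one, mul_comm b a]
    field_simp
    ring
  | more n ih0 ih1 =>
    refine mul_left_cancel₀ (awUp_ne_zero h n) ?_
    have hs := aw_symm_algebra q a b c d (q ^ n) h.a_ne h.b_ne
      (by have := h.abcd (2 * n); rwa [pow_mul'] at this)
      (by have := h.abcd (2 * n + 1); rwa [pow_succ, pow_mul', ← mul_assoc] at this)
      (by have := h.abcd (2 * n + 2); rwa [pow_add, pow_mul', ← mul_assoc] at this)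
    rw [awSeries_recurrence h, ← mul_assoc, awUp_mul_awSwap h, hs, ih0, ih1]
    linear_combination (-awSwap q a b c d (n + 1)) * awSeries_recurrence h.swap n x -
      awSeries q b a c d n x * awDown_mul_awSwap h n

/-- Raising the second and fourth parameters: the common factor of the shifted coefficients. -/
lemma awCoeff_shift_same {q a b c d : ℂ} (h : AWRegular q a b c d) (n k : ℕ) :
    awCoeff q b (a * q) d (c * q) (n + 2) k = awCoeff q b a c d (n + 2) k *
      ((1 - a * b) * (1 - b * c) / ((1 - a * b * q ^ k) * (1 - b * c * q ^ k))) *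
      ((1 - a * b * c * d * q ^ n * q * q ^ k) * (1 - a * b * c * d * q ^ n * q ^ 2 * q ^ k) /
        ((1 - a * b * c * d * q ^ n * q) * (1 - a * b * c * d * q ^ n * q ^ 2))) := by
  have hq := h.q_ne
  have h1 := qPoch_mul_left (a * b) q k
  have h2 := qPoch_mul_left (b * c) q k
  have h3 := qPoch_mul_left (a * b * c * d * q ^ n * q) q k
  have h4 := qPoch_mul_left (a * b * c * d * q ^ n * q ^ 2) q k
  have n1 := h.ab 0
  have n2 := h.bc 0
  have n3 := h.abcd (n + 1)
  have n4 := h.abcd (n + 2)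
  have n5 := h.ab k
  have n6 := h.bc k
  simp only [pow_zero, mul_one] at n1 n2
  rw [pow_add, ← mul_assoc] at n3 n4
  rw [pow_one] at n3
  rw [mul_comm] at h1 h2 h3 h4
  rw [← eq_div_iff n1] at h1
  rw [← eq_div_iff n2] at h2
  rw [← eq_div_iff n3] at h3
  rw [← eq_div_iff n4] at h4
  have e1 : b * (a * q) * d * (c * q) / q * q ^ (n + 2) =
      a * b * c * d * q ^ n * q ^ 2 * q := by
    field_simp
    ring
  have e2 : b * a * c * d / q * q ^ (n + 2) = a * b * c * d * q ^ n * q := by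
    field_simp
    ring
  have e3 : a * b * c * d * q ^ n * q ^ 2 = a * b * c * d * q ^ n * q * q := by ring
  unfold awCoeff
  rw [e1, e2, h4, e3, h3, show b * (a * q) = a * b * q by ring,
    show b * (c * q) = b * c * q by ring, h1, h2, mul_comm b a]
  simp only [div_eq_mul_inv, mul_inv, inv_inv]
  ring

lemma awCoeff_lower {q : ℂ} (hq : q ≠ 0) (a b c d : ℂ) (n k : ℕ) (hqn : 1 - q * q ^ n ≠ 0)
    (hD : 1 - a * b * c * d / q * q ^ n * q ^ k ≠ 0) :
    awCoeff q a b c d n k = awCoeff q a b c d (n + 1) k *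
      ((1 - q ^ k / (q ^ n * q)) / (1 - 1 / (q ^ n * q)) *
        ((1 - a * b * c * d / q * q ^ n) / (1 - a * b * c * d / q * q ^ n * q ^ k))) := by
  have hn : 1 - (q ^ (n + 1))⁻¹ ≠ 0 := by
    intro h0
    apply hqn
    rw [← pow_succ', sub_eq_zero]
    exact (inv_eq_one.1 (sub_eq_zero.1 h0).symm).symm
  have h1 := qPoch_mul_left ((q ^ (n + 1))⁻¹) q k
  have h2 := qPoch_mul_left (a * b * c * d / q * q ^ n) q k
  have e3 : (q ^ (n + 1))⁻¹ * q = (q ^ n)⁻¹ := by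
    rw [pow_succ q n]
    field_simp
  rw [e3, mul_comm, ← eq_div_iff hn] at h1
  rw [eq_comm, ← eq_div_iff hD] at h2
  unfold awCoeff
  rw [h1, h2, pow_succ]
  simp only [div_eq_mul_inv, mul_inv, one_mul]
  ring_nf

lemma qJacobi_contiguous_algebra (a g u P K : ℂ) (hg : g ≠ 0)
    (h1 : 1 - a * g * (P ^ 2 * u ^ 4) ≠ 0) (h2 : 1 - a * g * u * (P ^ 2 * u ^ 4) ≠ 0)
    (h3 : 1 - a * g * (P ^ 2 * u ^ 3) ≠ 0) :
    (1 + a * g * (P ^ 2 * u ^ 4)) * (1 - a ^ 2 * u * K) * (1 + a * g * u * K) =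
      (1 - a ^ 2 * g ^ 2 * (P ^ 2 * u ^ 4) * K) * (1 - a ^ 2 * g ^ 2 * u ^ 2 * (P ^ 2 * u ^ 4) * K) *
        (1 - a ^ 2 * u * (P ^ 2 * u ^ 4)) /
        ((1 - a * g * (P ^ 2 * u ^ 4)) * (1 - a * g * u * (P ^ 2 * u ^ 4))) -
      a * g * u * (1 + a * g * (P ^ 2 * u ^ 4)) * (1 - a / g) * (P ^ 2 * u ^ 4 - K) *
        (1 - a ^ 2 * g ^ 2 * (P ^ 2 * u ^ 4) * K) /
        ((1 - a * g * (P ^ 2 * u ^ 3)) * (1 - a * g * u * (P ^ 2 * u ^ 4))) -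
      a ^ 3 * g * u ^ 2 * (1 - g ^ 2 * (P ^ 2 * u ^ 3)) * (P ^ 2 * u ^ 4 - K) *
        (P ^ 2 * u ^ 2 - K) /
        ((1 - a * g * (P ^ 2 * u ^ 3)) * (1 - a * g * (P ^ 2 * u ^ 4))) := by
  generalize e1 : 1 - a * g * (P ^ 2 * u ^ 4) = E1 at *
  generalize e2 : 1 - a * g * u * (P ^ 2 * u ^ 4) = E2 at *
  generalize e3 : 1 - a * g * (P ^ 2 * u ^ 3) = E3 at *
  field_simp
  subst e1 e2 e3
  ring

lemma rpw_add {q : ℝ} (hq : 0 < q) (s t : ℝ) : rpw q (s + t) = rpw q s * rpw q t := by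
  simp [rpw, Real.rpow_add hq]

lemma rpw_pow {q : ℝ} (hq : 0 < q) (t : ℝ) (k : ℕ) : rpw q t ^ k = rpw q (t * k) := by
  simp [rpw, Real.rpow_mul_natCast hq.le]

lemma rpw_neg {q : ℝ} (hq : 0 < q) (t : ℝ) : rpw q (-t) = (rpw q t)⁻¹ := by
  simp [rpw, Real.rpow_neg hq.le]

lemma rpw_ne_zero {q : ℝ} (hq : 0 < q) (t : ℝ) : rpw q t ≠ 0 := by
  simpa [rpw] using (Real.rpow_pos_of_pos hq t).ne'

lemma one_sub_rpw_ne_zero {q : ℝ} (hq0 : 0 < q) (hq1 : q < 1) {t : ℝ} (ht : 0 < t) :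
    1 - rpw q t ≠ 0 := by
  rw [rpw, sub_ne_zero]
  exact_mod_cast (Real.rpow_lt_one hq0.le hq1 ht).ne'

lemma one_add_rpw_ne_zero {q : ℝ} (hq : 0 < q) (t : ℝ) : 1 + rpw q t ≠ 0 := by
  rw [rpw]
  exact_mod_cast (add_pos one_pos (Real.rpow_pos_of_pos hq t)).ne'

lemma ofReal_eq_rpw {q : ℝ} (hq : 0 < q) : (q : ℂ) = rpw q (1 / 2) ^ 2 := by
  rw [rpw_pow hq]
  norm_num [rpw]

/-- Continuous q-Jacobi polynomials as Askey-Wilson series. -/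
lemma Paw_eq_awSeries {q : ℝ} (hq : 0 < q) (α β : ℝ) (n : ℕ) (x : ℂ) {u a g : ℂ}
    (hu : u = rpw q (1 / 2)) (ha : a = rpw q ((2 * α + 1) / 4))
    (hg : g = rpw q ((2 * β + 1) / 4)) :
    Paw q α β n x = qPoch (a * (a * u)) (u ^ 2) n / qPoch (u ^ 2) (u ^ 2) n *
      awSeries (u ^ 2) a (a * u) (-g) (-(g * u)) n x := by
  have hu0 : u ≠ 0 := hu ▸ rpw_ne_zero hq _
  have e1 : rpw q (α + 1) = a * (a * u) := by
    simp only [hu, ha, ← rpw_add hq]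
    congr 1
    ring
  have e2 : rpw q (-(n : ℝ)) = ((u ^ 2) ^ n)⁻¹ := by
    simp only [hu, rpw_pow hq, ← rpw_neg hq]
    congr 1
    push_cast
    ring
  have e3 : rpw q ((n : ℝ) + α + β + 1) = a * (a * u) * -g * -(g * u) / u ^ 2 * (u ^ 2) ^ n := by
    rw [show a * (a * u) * -g * -(g * u) / u ^ 2 * (u ^ 2) ^ n = a * a * g * g * (u ^ 2) ^ n by
      field_simp]
    simp only [hu, ha, hg, rpw_pow hq, ← rpw_add hq]
    congr 1
    push_cast
    ring
  have e4 : -rpw q ((α + β + 1) / 2) = a * -g := by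
    rw [mul_neg, neg_inj]
    simp only [ha, hg, ← rpw_add hq]
    congr 1
    ring
  have e5 : -rpw q ((α + β + 2) / 2) = a * -(g * u) := by
    rw [mul_neg, neg_inj]
    simp only [hu, ha, hg, ← rpw_add hq]
    congr 1
    ring
  have e6 (j : ℕ) : rpw q ((2 * α + 1) / 4 + (j : ℝ)) = a * (u ^ 2) ^ j := by
    simp only [hu, ha, rpw_pow hq, ← rpw_add hq]
    congr 1
    push_cast
    ring
  have e7 (j : ℕ) : rpw q ((2 * α + 1) / 2 + 2 * (j : ℝ)) = (a * (u ^ 2) ^ j) ^ 2 := by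
    simp only [hu, ha, rpw_pow hq, ← rpw_add hq]
    congr 1
    push_cast
    ring
  unfold Paw awSeries awCoeff awBasis
  simp only [e1, e2, e3, e4, e5, e6, e7, ofReal_eq_rpw hq, ← hu]

lemma awRegular_qJacobi {q α β : ℝ} (hq0 : 0 < q) (hq1 : q < 1) (hα : -1 < α) (hβ : -1 < β)
    {u a g : ℂ} (hu : u = rpw q (1 / 2)) (ha : a = rpw q ((2 * α + 1) / 4))
    (hg : g = rpw q ((2 * β + 1) / 4)) :
    AWRegular (u ^ 2) a (a * u) (-g) (-(g * u)) := by
  have hu0 : u ≠ 0 := hu ▸ rpw_ne_zero hq0 _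
  have ha0 : a ≠ 0 := ha ▸ rpw_ne_zero hq0 _
  refine ⟨pow_ne_zero 2 hu0, ha0, mul_ne_zero ha0 hu0, fun k => ?_, fun k => ?_, fun k => ?_,
    fun k => ?_, fun k => ?_, fun k => ?_, fun k => ?_⟩
  · simp only [hu, rpw_pow hq0, ← rpw_add hq0]
    exact one_sub_rpw_ne_zero hq0 hq1 (by positivity)
  · simp only [hu, ha, rpw_pow hq0, ← rpw_add hq0]
    refine one_sub_rpw_ne_zero hq0 hq1 ?_
    push_cast
    linarith [k.cast_nonneg (α := ℝ)]
  · simp only [mul_neg, neg_mul, sub_neg_eq_add, hu, ha, hg, rpw_pow hq0, ← rpw_add hq0]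
    exact one_add_rpw_ne_zero hq0 _
  · simp only [mul_neg, neg_mul, sub_neg_eq_add, hu, ha, hg, rpw_pow hq0, ← rpw_add hq0]
    exact one_add_rpw_ne_zero hq0 _
  · simp only [mul_neg, neg_mul, sub_neg_eq_add, hu, ha, hg, rpw_pow hq0, ← rpw_add hq0]
    exact one_add_rpw_ne_zero hq0 _
  · simp only [mul_neg, neg_mul, sub_neg_eq_add, hu, ha, hg, rpw_pow hq0, ← rpw_add hq0]
    exact one_add_rpw_ne_zero hq0 _
  · simp only [mul_neg, neg_mul, neg_neg, hu, ha, hg, rpw_pow hq0, ← rpw_add hq0]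
    refine one_sub_rpw_ne_zero hq0 hq1 ?_
    push_cast
    linarith [k.cast_nonneg (α := ℝ)]

lemma awSwap_qJacobi {u a g : ℂ} (h : AWRegular (u ^ 2) a (a * u) (-g) (-(g * u))) (n : ℕ) :
    awSwap (u ^ 2) a (a * u) (-g) (-(g * u)) n =
      (1 + a * g * (u ^ 2) ^ n) / ((1 + a * g) * u ^ n) := by
  have ha := h.a_ne
  have h1 := qPoch_mul_left (a * -g) (u ^ 2) n
  have h2 := qPoch_ne_zero h.ac n
  have h3 := qPoch_ne_zero h.ad n
  have h4 := h.ac 0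
  have hau : a / (a * u) = u⁻¹ := by
    field_simp
  rw [pow_zero, mul_one] at h4
  rw [eq_comm, mul_comm (1 - a * -g), eq_comm, ← eq_div_iff h4] at h1
  unfold awSwap
  rw [show a * u * -(g * u) = a * -g * u ^ 2 by ring, show a * u * -g = a * -(g * u) by ring, h1,
    hau]
  rw [show 1 + a * g = 1 - a * -g by ring,
    show 1 + a * g * (u ^ 2) ^ n = 1 - a * -g * (u ^ 2) ^ n by ring]
  generalize 1 - a * -g = E at *
  generalize qPoch (a * -g) (u ^ 2) n = E1 at *
  generalize qPoch (a * -(g * u)) (u ^ 2) n = E2 at *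
  rw [inv_pow]
  field_simp

/-- The contiguous relation between the coefficients of the q-Jacobi series, where `q = u ^ 2`. -/
lemma qJacobi_coeff_contiguous {u a g : ℂ} (hg : g ≠ 0)
    (h : AWRegular (u ^ 2) a (a * u) (-g) (-(g * u))) (m k : ℕ) (P : ℂ) (hP : P = u ^ m)
    (h1 : 1 - a * g * (P ^ 2 * u ^ 4) ≠ 0) (h2 : 1 - a * g * u * (P ^ 2 * u ^ 4) ≠ 0)
    (h3 : 1 - a * g * (P ^ 2 * u ^ 3) ≠ 0) :
    qPoch (a * (a * u)) (u ^ 2) (m + 2) / qPoch (u ^ 2) (u ^ 2) (m + 2) *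
        (awSwap (u ^ 2) a (a * u) (-g) (-(g * u)) (m + 2) *
          awCoeff (u ^ 2) (a * u) a (-g) (-(g * u)) (m + 2) k) =
      (P * u ^ 2)⁻¹ * (1 - a ^ 2 * g ^ 2 * (P ^ 2 * u ^ 4)) *
          (1 - a ^ 2 * g ^ 2 * u ^ 2 * (P ^ 2 * u ^ 4)) /
          ((1 + a * g) * (1 + a * g * u) * (1 - a * g * (P ^ 2 * u ^ 4)) *
            (1 - a * g * u * (P ^ 2 * u ^ 4))) *
        (qPoch (a * (a * u) * u ^ 2) (u ^ 2) (m + 2) / qPoch (u ^ 2) (u ^ 2) (m + 2) *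
          awCoeff (u ^ 2) (a * u) (a * u ^ 2) (-(g * u)) (-g * u ^ 2) (m + 2) k) +
      a * g * u * (P * u ^ 2)⁻¹ * (1 - a ^ 2 * g ^ 2 * (P ^ 2 * u ^ 4)) *
          (1 + a * g * (P ^ 2 * u ^ 4)) * (1 - a / g) /
          ((1 + a * g) * (1 + a * g * u) * (1 - a * g * (P ^ 2 * u ^ 3)) *
            (1 - a * g * u * (P ^ 2 * u ^ 4))) *
        (qPoch (a * (a * u) * u ^ 2) (u ^ 2) (m + 1) / qPoch (u ^ 2) (u ^ 2) (m + 1) *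
          awCoeff (u ^ 2) (a * u) (a * u ^ 2) (-(g * u)) (-g * u ^ 2) (m + 1) k) -
      a ^ 3 * g * u ^ 2 * (P * u ^ 2)⁻¹ * (1 - a ^ 2 * (P ^ 2 * u ^ 3)) *
          (1 - g ^ 2 * (P ^ 2 * u ^ 3)) /
          ((1 + a * g) * (1 + a * g * u) * (1 - a * g * (P ^ 2 * u ^ 3)) *
            (1 - a * g * (P ^ 2 * u ^ 4))) *
        (qPoch (a * (a * u) * u ^ 2) (u ^ 2) m / qPoch (u ^ 2) (u ^ 2) m *
          awCoeff (u ^ 2) (a * u) (a * u ^ 2) (-(g * u)) (-g * u ^ 2) m k) := by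
  have hq := h.q_ne
  have hu : u ≠ 0 := by
    rintro rfl
    exact hq (by simp)
  have hP0 : P ≠ 0 := hP ▸ pow_ne_zero m hu
  have hPm : (u ^ 2) ^ m = P ^ 2 := by rw [hP, pow_right_comm]
  have hPm1 : (u ^ 2) ^ (m + 1) = P ^ 2 * u ^ 2 := by rw [pow_succ, hPm]
  have hPm2 : (u ^ 2) ^ (m + 2) = P ^ 2 * u ^ 4 := by rw [pow_add, hPm]; ring
  have hqm := qPoch_ne_zero h.qq m
  have hc : 1 + a * g ≠ 0 := by simpa using h.ac 0
  have hB : 1 + a * g * u ≠ 0 := by simpa [mul_assoc] using h.ad 0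
  have n1 := h.qq m
  have n2 := h.qq (m + 1)
  have hR1 : 1 - P ^ 2 * u ^ 2 ≠ 0 := by rwa [hPm, mul_comm] at n1
  have hR2 : 1 - P ^ 2 * u ^ 4 ≠ 0 := by
    rw [hPm1] at n2
    convert n2 using 1
    ring
  have hD1 (j : ℕ) : 1 - a ^ 2 * g ^ 2 * (P ^ 2 * u ^ 4) * (u ^ 2) ^ j ≠ 0 := by
    have := h.abcd (m + 1 + j)
    rw [pow_add _ (m + 1), hPm1] at this
    convert this using 1
    ring
  have hD2 (j : ℕ) : 1 - a ^ 2 * g ^ 2 * u ^ 2 * (P ^ 2 * u ^ 4) * (u ^ 2) ^ j ≠ 0 := by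
    have := h.abcd (m + 2 + j)
    rw [pow_add _ (m + 2), hPm2] at this
    convert this using 1
    ring
  have hA : 1 - a ^ 2 * u * (u ^ 2) ^ k ≠ 0 := by
    convert h.ab k using 1
    ring
  have hBk : 1 + a * g * u * (u ^ 2) ^ k ≠ 0 := by
    convert h.ad k using 1
    ring
  have hD : a * u * (a * u ^ 2) * -(g * u) * (-g * u ^ 2) / u ^ 2 =
      a ^ 2 * g ^ 2 * u ^ 4 := by
    field_simp
  have hD1k := hD1 k
  have hD2k := hD2 k
  have hD10 := hD1 0
  have hD20 := hD2 0
  rw [pow_zero, mul_one] at hD10 hD20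
  have shift2 : awCoeff (u ^ 2) (a * u) (a * u ^ 2) (-(g * u)) (-g * u ^ 2) (m + 2) k =
      awCoeff (u ^ 2) (a * u) a (-g) (-(g * u)) (m + 2) k *
      ((1 - a ^ 2 * u) * (1 + a * g * u) /
        ((1 - a ^ 2 * u * (u ^ 2) ^ k) * (1 + a * g * u * (u ^ 2) ^ k))) *
      ((1 - a ^ 2 * g ^ 2 * (P ^ 2 * u ^ 4) * (u ^ 2) ^ k) *
          (1 - a ^ 2 * g ^ 2 * u ^ 2 * (P ^ 2 * u ^ 4) * (u ^ 2) ^ k) /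
        ((1 - a ^ 2 * g ^ 2 * (P ^ 2 * u ^ 4)) *
          (1 - a ^ 2 * g ^ 2 * u ^ 2 * (P ^ 2 * u ^ 4)))) := by
    rw [awCoeff_shift_same h, hPm]
    congr 1
    · congr 2 <;> ring
    · congr 1 <;> ring
  have shift1 : awCoeff (u ^ 2) (a * u) (a * u ^ 2) (-(g * u)) (-g * u ^ 2) (m + 1) k =
      awCoeff (u ^ 2) (a * u) (a * u ^ 2) (-(g * u)) (-g * u ^ 2) (m + 2) k *
      (-(P ^ 2 * u ^ 4 - (u ^ 2) ^ k) / (1 - P ^ 2 * u ^ 4) *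
        ((1 - a ^ 2 * g ^ 2 * u ^ 2 * (P ^ 2 * u ^ 4)) /
          (1 - a ^ 2 * g ^ 2 * u ^ 2 * (P ^ 2 * u ^ 4) * (u ^ 2) ^ k))) := by
    rw [awCoeff_lower hq (a * u) (a * u ^ 2) (-(g * u)) (-g * u ^ 2) (m + 1) k n2
      (by rw [hD, hPm1]; convert hD2k using 1; ring), hD, hPm1]
    congr 2
    · rw [show 1 - 1 / (P ^ 2 * u ^ 2 * u ^ 2) = -(1 - P ^ 2 * u ^ 4) / (P ^ 2 * u ^ 4) by
        field_simp; ring]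
      generalize 1 - P ^ 2 * u ^ 4 = E at *
      field_simp
    · congr 1 <;> ring
  have shift0 : awCoeff (u ^ 2) (a * u) (a * u ^ 2) (-(g * u)) (-g * u ^ 2) m k =
      awCoeff (u ^ 2) (a * u) (a * u ^ 2) (-(g * u)) (-g * u ^ 2) (m + 1) k *
      (-(P ^ 2 * u ^ 2 - (u ^ 2) ^ k) / (1 - P ^ 2 * u ^ 2) *
        ((1 - a ^ 2 * g ^ 2 * (P ^ 2 * u ^ 4)) /
          (1 - a ^ 2 * g ^ 2 * (P ^ 2 * u ^ 4) * (u ^ 2) ^ k))) := by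
    rw [awCoeff_lower hq (a * u) (a * u ^ 2) (-(g * u)) (-g * u ^ 2) m k n1
      (by rw [hD, hPm]; convert hD1k using 1; ring), hD, hPm]
    congr 2
    · rw [show 1 - 1 / (P ^ 2 * u ^ 2) = -(1 - P ^ 2 * u ^ 2) / (P ^ 2 * u ^ 2) by
        field_simp; ring]
      generalize 1 - P ^ 2 * u ^ 2 = E at *
      field_simp
    · congr 1 <;> ring
  have q1 : qPoch (u ^ 2) (u ^ 2) (m + 1) = qPoch (u ^ 2) (u ^ 2) m * (1 - P ^ 2 * u ^ 2) := by
    rw [qPoch_succ, hPm, mul_comm (u ^ 2) (P ^ 2)]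
  have q2 : qPoch (u ^ 2) (u ^ 2) (m + 2) = qPoch (u ^ 2) (u ^ 2) m *
      ((1 - P ^ 2 * u ^ 2) * (1 - P ^ 2 * u ^ 4)) := by
    rw [qPoch_succ, q1, hPm1]
    ring
  have r1 : qPoch (a * (a * u) * u ^ 2) (u ^ 2) (m + 1) =
      qPoch (a * (a * u) * u ^ 2) (u ^ 2) m * (1 - a ^ 2 * u ^ 3 * P ^ 2) := by
    rw [qPoch_succ, hPm]
    ring
  have r2 : qPoch (a * (a * u) * u ^ 2) (u ^ 2) (m + 2) = qPoch (a * (a * u) * u ^ 2) (u ^ 2) m *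
      ((1 - a ^ 2 * u ^ 3 * P ^ 2) * (1 - a ^ 2 * u * (P ^ 2 * u ^ 4))) := by
    rw [qPoch_succ, r1, hPm1]
    ring
  have r3 : qPoch (a * (a * u)) (u ^ 2) (m + 2) = qPoch (a * (a * u) * u ^ 2) (u ^ 2) m *
      ((1 - a ^ 2 * u) * (1 - a ^ 2 * u ^ 3 * P ^ 2)) := by
    rw [qPoch_succ_left, r1]
    ring
  have key := qJacobi_contiguous_algebra a g u P ((u ^ 2) ^ k) hg h1 h2 h3
  rw [shift0, shift1, shift2, q1, q2, r1, r2, r3, awSwap_qJacobi h, hPm2, pow_add u m 2, ← hP,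
    show a ^ 2 * (P ^ 2 * u ^ 3) = a ^ 2 * u ^ 3 * P ^ 2 by ring]
  clear shift0 shift1 shift2 q1 q2 r1 r2 r3 hPm hPm1 hPm2 hD1 hD2 n1 n2 hP h hD
  generalize (u ^ 2) ^ k = K at *
  generalize awCoeff (u ^ 2) (a * u) a (-g) (-(g * u)) (m + 2) k = e
  generalize qPoch (a * (a * u) * u ^ 2) (u ^ 2) m = F
  generalize qPoch (u ^ 2) (u ^ 2) m = R at *
  generalize 1 - a ^ 2 * g ^ 2 * (P ^ 2 * u ^ 4) * K = D1k at *
  generalize 1 - a ^ 2 * g ^ 2 * u ^ 2 * (P ^ 2 * u ^ 4) * K = D2k at *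
  generalize 1 - a ^ 2 * g ^ 2 * (P ^ 2 * u ^ 4) = D1 at *
  generalize 1 - a ^ 2 * g ^ 2 * u ^ 2 * (P ^ 2 * u ^ 4) = D2 at *
  generalize 1 - a * g * (P ^ 2 * u ^ 4) = E1 at *
  generalize 1 - a * g * u * (P ^ 2 * u ^ 4) = E2 at *
  generalize 1 - a * g * (P ^ 2 * u ^ 3) = E3 at *
  generalize 1 + a * g * (P ^ 2 * u ^ 4) = E4 at *
  generalize 1 - a ^ 2 * u * (P ^ 2 * u ^ 4) = E5 at *
  generalize 1 - g ^ 2 * (P ^ 2 * u ^ 3) = E6 at *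
  generalize 1 - a ^ 2 * u ^ 3 * P ^ 2 = A1 at *
  generalize 1 - a ^ 2 * u * K = Ak at *
  generalize 1 + a * g * u * K = Bk at *
  generalize 1 + a * g * u = B at *
  generalize 1 + a * g = c at *
  generalize 1 - a ^ 2 * u = A0 at *
  generalize 1 - P ^ 2 * u ^ 2 = R1 at *
  generalize 1 - P ^ 2 * u ^ 4 = R2 at *
  generalize P ^ 2 * u ^ 4 - K = G1 at *
  generalize P ^ 2 * u ^ 2 - K = G2 at *
  generalize 1 - a / g = G3 at *
  trans e * F * A0 * A1 / (R * R1 * R2 * P * u ^ 2 * c * Ak * Bk) * (E4 * Ak * Bk)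
  · field_simp
  · rw [key]
    field_simp
    ring

theorem statement1 (q α β : ℝ) (hq0 : 0 < q) (hq1 : q < 1)
    (hα : -1 < α) (hβ : -1 < β) (n : ℕ) (hn : 2 ≤ n) (x : ℂ) :
    Paw q α β n x =
    (rpw q (-(n : ℝ)/2) * (1 - rpw q (α + β + (n : ℝ) + 1)) * (1 - rpw q (α + β + (n : ℝ) + 2)) /
      ((1 + rpw q ((α + β + 1)/2)) * (1 + rpw q ((α + β + 2)/2)) *
       (1 - rpw q ((n : ℝ) + (α + β + 1)/2)) * (1 - rpw q ((n : ℝ) + (α + β + 2)/2)))) *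
      Paw q (α + 1) (β + 1) n x
    + (rpw q ((α + β + 2 - (n : ℝ))/2) * (1 - rpw q (α + β + (n : ℝ) + 1)) *
        (1 + rpw q ((n : ℝ) + (α + β + 1)/2)) * (1 - rpw q ((α - β)/2)) /
      ((1 + rpw q ((α + β + 1)/2)) * (1 + rpw q ((α + β + 2)/2)) *
       (1 - rpw q ((n : ℝ) + (α + β)/2)) * (1 - rpw q ((n : ℝ) + (α + β + 2)/2)))) *
      Paw q (α + 1) (β + 1) (n - 1) x
    - (rpw q ((3*α + β + 4 - (n : ℝ))/2) * (1 - rpw q (α + (n : ℝ))) * (1 - rpw q (β + (n : ℝ))) /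
      ((1 + rpw q ((α + β + 1)/2)) * (1 + rpw q ((α + β + 2)/2)) *
       (1 - rpw q ((n : ℝ) + (α + β)/2)) * (1 - rpw q ((n : ℝ) + (α + β + 1)/2)))) *
      Paw q (α + 1) (β + 1) (n - 2) x := by
  obtain ⟨m, rfl⟩ : ∃ m, n = m + 2 := ⟨n - 2, by omega⟩
  obtain ⟨u, hu⟩ : ∃ u, u = rpw q (1 / 2) := ⟨_, rfl⟩
  obtain ⟨a, ha⟩ : ∃ a, a = rpw q ((2 * α + 1) / 4) := ⟨_, rfl⟩
  obtain ⟨g, hg⟩ : ∃ g, g = rpw q ((2 * β + 1) / 4) := ⟨_, rfl⟩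
  obtain ⟨P, hP⟩ : ∃ P, P = u ^ m := ⟨_, rfl⟩
  have hau : a * u = rpw q ((2 * (α + 1) + 1) / 4) := by
    rw [ha, hu, ← rpw_add hq0]
    congr 1
    ring
  have hgu : g * u = rpw q ((2 * (β + 1) + 1) / 4) := by
    rw [hg, hu, ← rpw_add hq0]
    congr 1
    ring
  have eNeg : rpw q (-(((m + 2 : ℕ) : ℝ)) / 2) = (P * u ^ 2)⁻¹ := by
    simp only [hP, hu, rpw_pow hq0, ← rpw_neg hq0, ← rpw_add hq0]
    congr 1
    push_cast
    ring
  have eD1 : rpw q (α + β + ((m + 2 : ℕ) : ℝ) + 1) = a ^ 2 * g ^ 2 * (P ^ 2 * u ^ 4) := by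
    simp only [hP, hu, ha, hg, rpw_pow hq0, ← rpw_add hq0]
    congr 1
    push_cast
    ring
  have eD2 : rpw q (α + β + ((m + 2 : ℕ) : ℝ) + 2) = a ^ 2 * g ^ 2 * u ^ 2 * (P ^ 2 * u ^ 4) := by
    simp only [hP, hu, ha, hg, rpw_pow hq0, ← rpw_add hq0]
    congr 1
    push_cast
    ring
  have eC : rpw q ((α + β + 1) / 2) = a * g := by
    simp only [ha, hg, ← rpw_add hq0]
    congr 1
    ring
  have eB : rpw q ((α + β + 2) / 2) = a * g * u := by
    simp only [hu, ha, hg, ← rpw_add hq0]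
    congr 1
    ring
  have eE1 : rpw q (((m + 2 : ℕ) : ℝ) + (α + β + 1) / 2) = a * g * (P ^ 2 * u ^ 4) := by
    simp only [hP, hu, ha, hg, rpw_pow hq0, ← rpw_add hq0]
    congr 1
    push_cast
    ring
  have eE2 : rpw q (((m + 2 : ℕ) : ℝ) + (α + β + 2) / 2) = a * g * u * (P ^ 2 * u ^ 4) := by
    simp only [hP, hu, ha, hg, rpw_pow hq0, ← rpw_add hq0]
    congr 1
    push_cast
    ring
  have eInv : rpw q ((α + β + 2 - ((m + 2 : ℕ) : ℝ)) / 2) = a * g * u * (P * u ^ 2)⁻¹ := by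
    simp only [hP, hu, ha, hg, rpw_pow hq0, ← rpw_neg hq0, ← rpw_add hq0]
    congr 1
    push_cast
    ring
  have eRatio : rpw q ((α - β) / 2) = a / g := by
    simp only [ha, hg, div_eq_mul_inv, ← rpw_neg hq0, ← rpw_add hq0]
    congr 1
    ring
  have eE3 : rpw q (((m + 2 : ℕ) : ℝ) + (α + β) / 2) = a * g * (P ^ 2 * u ^ 3) := by
    simp only [hP, hu, ha, hg, rpw_pow hq0, ← rpw_add hq0]
    congr 1
    push_cast
    ring
  have eInv3 : rpw q ((3 * α + β + 4 - ((m + 2 : ℕ) : ℝ)) / 2) =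
      a ^ 3 * g * u ^ 2 * (P * u ^ 2)⁻¹ := by
    simp only [hP, hu, ha, hg, rpw_pow hq0, ← rpw_neg hq0, ← rpw_add hq0]
    congr 1
    push_cast
    ring
  have eA : rpw q (α + ((m + 2 : ℕ) : ℝ)) = a ^ 2 * (P ^ 2 * u ^ 3) := by
    simp only [hP, hu, ha, rpw_pow hq0, ← rpw_add hq0]
    congr 1
    push_cast
    ring
  have eG : rpw q (β + ((m + 2 : ℕ) : ℝ)) = g ^ 2 * (P ^ 2 * u ^ 3) := by
    simp only [hP, hu, hg, rpw_pow hq0, ← rpw_add hq0]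
    congr 1
    push_cast
    ring
  have h_g : g ≠ 0 := hg ▸ rpw_ne_zero hq0 _
  have h := awRegular_qJacobi hq0 hq1 hα hβ hu ha hg
  have hm : (0 : ℝ) ≤ m := m.cast_nonneg
  have h1 := one_sub_rpw_ne_zero hq0 hq1
    (show 0 < ((m + 2 : ℕ) : ℝ) + (α + β + 1) / 2 by push_cast; linarith)
  have h2 := one_sub_rpw_ne_zero hq0 hq1
    (show 0 < ((m + 2 : ℕ) : ℝ) + (α + β + 2) / 2 by push_cast; linarith)
  have h3 := one_sub_rpw_ne_zero hq0 hq1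
    (show 0 < ((m + 2 : ℕ) : ℝ) + (α + β) / 2 by push_cast; linarith)
  rw [eE1] at h1
  rw [eE2] at h2
  rw [eE3] at h3
  have shifted (i : ℕ) (hi : i < m + 3) : Paw q (α + 1) (β + 1) i x =
      ∑ k ∈ range (m + 3), qPoch (a * (a * u) * u ^ 2) (u ^ 2) i / qPoch (u ^ 2) (u ^ 2) i *
        awCoeff (u ^ 2) (a * u) (a * u ^ 2) (-(g * u)) (-g * u ^ 2) i k *
          awBasis (u ^ 2) (a * u) x k := by
    rw [Paw_eq_awSeries hq0 _ _ i x hu hau hgu, awSeries_eq_sum h.q_ne _ _ _ _ _ hi,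
      show a * u * (a * u * u) = a * (a * u) * u ^ 2 by ring,
      show a * u * u = a * u ^ 2 by ring, show -(g * u * u) = -g * u ^ 2 by ring, mul_sum]
    simp only [mul_assoc]
  rw [show m + 2 - 1 = m + 1 by omega, show m + 2 - 2 = m by omega,
    shifted (m + 2) (by omega), shifted (m + 1) (by omega), shifted m (by omega),
    Paw_eq_awSeries hq0 α β (m + 2) x hu ha hg, awSeries_swap h,
    awSeries_eq_sum h.q_ne _ _ _ _ _ (show m + 2 < m + 3 by omega),
    eNeg, eD1, eD2, eC, eB, eE1, eE2, eInv, eRatio, eE3, eInv3, eA, eG]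
  simp only [mul_sum, ← sum_add_distrib, ← sum_sub_distrib]
  refine sum_congr rfl fun k _ => ?_
  linear_combination awBasis (u ^ 2) (a * u) x k *
    qJacobi_coeff_contiguous h_g h m k P hP h1 h2 h3
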